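/- Let c>0 and z(t,ξ)=(t·B_g(f(ξ))+Δ(f(ξ)))/π. For every integer N≥1 and every sufficiently small ε>0 there exists T=T(ε,N) such that for all t>T and all x satisfying 4c²t − ((2N+1/2−ε)/(2c))·log t ≤ x ≤ 4c²t − ((1/2+ε)/(2c))·log t, one has 0 ≤ z(t, x/(12t)) ≤ 2N. -/

import Mathlib

/-- `μ²(d) = (∫₀^d y²·√((d²−y²)/(c²−y²)) dy)/(∫₀^d √((d²−y²)/(c²−y²)) dy)`. -/
noncomputable def mu2 (c d : ℝ) : ℝ :=
  (∫ y in (0:ℝ)..d, y^2 * Real.sqrt ((d^2 - y^2) / (c^2 - y^2))) /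
    (∫ y in (0:ℝ)..d, Real.sqrt ((d^2 - y^2) / (c^2 - y^2)))

/-- `B_g(d) = 24·∫_d^c (y²−μ²(d))·√(y²−d²)/√(c²−y²) dy`. -/
noncomputable def Bg (c d : ℝ) : ℝ :=
  24 * ∫ y in d..c, (y^2 - mu2 c d) * Real.sqrt (y^2 - d^2) / Real.sqrt (c^2 - y^2)

/-- `I₁(d) = ∫₀^d dy/√((c²−y²)(d²−y²))`. -/
noncomputable def I1 (c d : ℝ) : ℝ :=
  ∫ y in (0:ℝ)..d, 1 / Real.sqrt ((c^2 - y^2) * (d^2 - y^2))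

/-- `I₂(d) = ∫_d^c log(c/(2√(c²−y²)))·dy/√((c²−y²)(y²−d²))`. -/
noncomputable def I2 (c d : ℝ) : ℝ :=
  ∫ y in d..c, Real.log (c / (2 * Real.sqrt (c^2 - y^2))) /
    Real.sqrt ((c^2 - y^2) * (y^2 - d^2))

/-- `Δ(d) = −I₂(d)/I₁(d)`. -/
noncomputable def Delta (c d : ℝ) : ℝ := -(I2 c d) / I1 c d

/-- The phase variable `z(t,ξ) = (t·B_g(f(ξ)) + Δ(f(ξ)))/π`. -/
noncomputable def zvar (c : ℝ) (f : ℝ → ℝ) (t ξ : ℝ) : ℝ :=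
  (t * Bg c (f ξ) + Delta c (f ξ)) / Real.pi

open Real Set Filter Topology MeasureTheory

lemma aux_Ioo_eq (F G : ℝ → ℝ) (h : ∀ φ ∈ Ioo 0 (π/2), F φ = G φ) :
    ∫ φ in Ioo 0 (π/2), F φ = ∫ φ in (0:ℝ)..(π/2), G φ := by
  rw [intervalIntegral.integral_of_le (by positivity), integral_Ioc_eq_integral_Ioo]
  exact setIntegral_congr_fun measurableSet_Ioo h

lemma sincos_pos {φ : ℝ} (h : φ ∈ Ioo 0 (π/2)) : 0 < sin φ ∧ 0 < cos φ :=
  ⟨sin_pos_of_pos_of_lt_pi h.1 (by linarith [h.2, pi_pos]),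
    cos_pos_of_mem_Ioo ⟨by linarith [h.1, pi_pos], h.2⟩⟩

lemma cv1 (d : ℝ) (hd : 0 < d) (g : ℝ → ℝ) :
    ∫ y in (0:ℝ)..d, g y = ∫ φ in Ioo 0 (π/2), (d * sin φ) * g (d * cos φ) := by
  have him : Set.image (fun φ => d * cos φ) (Ioo 0 (π/2)) = Ioo 0 d := by
    ext y
    constructor
    · rintro ⟨φ, hφ, rfl⟩
      obtain ⟨h1, h2⟩ := sincos_pos hφ
      refine ⟨by positivity, ?_⟩
      have : cos φ < 1 := by nlinarith [sin_sq_add_cos_sq φ]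
      show d * cos φ < d
      nlinarith
    · rintro ⟨h0, h1⟩
      have h2 : 0 < y / d := by positivity
      have h3 : y / d < 1 := (div_lt_one hd).2 h1
      refine ⟨arccos (y/d), ⟨arccos_pos.2 h3, arccos_lt_pi_div_two.2 h2⟩, ?_⟩
      show d * cos (arccos (y/d)) = y
      rw [cos_arccos (by linarith) h3.le]
      field_simp
  rw [intervalIntegral.integral_of_le hd.le, integral_Ioc_eq_integral_Ioo, ← him,
    integral_image_eq_integral_abs_deriv_smul (f' := fun φ => d * (-sin φ)) measurableSet_Ioo]
  · refine setIntegral_congr_fun measurableSet_Ioo ?_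
    intro φ hφ
    have := (sincos_pos hφ).1
    simp only [smul_eq_mul]
    rw [mul_neg, abs_neg, abs_of_pos (by positivity)]
  · intro φ _
    exact ((hasDerivAt_cos φ).const_mul d).hasDerivWithinAt
  · intro a ha b hb hab
    have : cos a = cos b := mul_left_cancel₀ hd.ne' hab
    exact injOn_cos ⟨ha.1.le, by linarith [ha.2, pi_pos]⟩ ⟨hb.1.le, by linarith [hb.2, pi_pos]⟩ this

/-- `y(θ) = √(c² - δ sin²θ)`. -/
noncomputable def yy (c d θ : ℝ) : ℝ := √(c^2 - (c^2 - d^2) * sin θ ^2)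

lemma yy_sq_pos {c d : ℝ} (hd : 0 < d) (hdc : d < c) (θ : ℝ) :
    d^2 ≤ c^2 - (c^2 - d^2) * sin θ ^2 := by
  have h : (c^2 - d^2) * sin θ ^2 ≤ (c^2 - d^2) * 1 :=
    mul_le_mul_of_nonneg_left (sin_sq_le_one θ) (by nlinarith)
  linarith

lemma yy_sq {c d : ℝ} (hd : 0 < d) (hdc : d < c) (θ : ℝ) :
    yy c d θ ^ 2 = c^2 - (c^2 - d^2) * sin θ ^2 :=
  sq_sqrt (by nlinarith [yy_sq_pos hd hdc θ])

lemma yy_ge {c d : ℝ} (hd : 0 < d) (hdc : d < c) (θ : ℝ) : d ≤ yy c d θ :=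
  le_sqrt_of_sq_le (yy_sq_pos hd hdc θ)

lemma yy_le {c d : ℝ} (hd : 0 < d) (hdc : d < c) (θ : ℝ) : yy c d θ ≤ c := by
  unfold yy
  rw [sqrt_le_left (by linarith)]
  have : 0 ≤ (c^2 - d^2) * sin θ ^2 := mul_nonneg (by nlinarith) (sq_nonneg _)
  linarith

lemma cv2 (c d : ℝ) (hd : 0 < d) (hdc : d < c) (g : ℝ → ℝ) :
    ∫ y in d..c, g y = ∫ θ in Ioo 0 (π/2),
      ((c^2 - d^2) * sin θ * cos θ / yy c d θ) * g (yy c d θ) := by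
  have hδ : 0 < c^2 - d^2 := by nlinarith
  have him : Set.image (fun θ => yy c d θ) (Ioo 0 (π/2)) = Ioo d c := by
    ext y
    constructor
    · rintro ⟨φ, hφ, rfl⟩
      obtain ⟨h1, h2⟩ := sincos_pos hφ
      have e := yy_sq hd hdc φ
      have hy := yy_ge hd hdc φ
      constructor
      · show d < yy c d φ
        have : sin φ ^2 < 1 := by nlinarith [sin_sq_add_cos_sq φ]
        nlinarith
      · show yy c d φ < c
        have : 0 < (c^2 - d^2) * sin φ ^2 := by positivity
        nlinarith
    · rintro ⟨h0, h1⟩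
      have h2 : 0 < (c^2 - y^2) / (c^2-d^2) := div_pos (by nlinarith) hδ
      have h3 : (c^2 - y^2) / (c^2-d^2) < 1 := (div_lt_one hδ).2 (by nlinarith)
      have h4 : √((c^2 - y^2) / (c^2-d^2)) < 1 := by
        rw [sqrt_lt' one_pos]; simpa using h3
      have h5 : 0 < √((c^2 - y^2) / (c^2-d^2)) := sqrt_pos.2 h2
      refine ⟨arcsin √((c^2 - y^2) / (c^2-d^2)), ⟨arcsin_pos.2 h5, arcsin_lt_pi_div_two.2 h4⟩, ?_⟩
      show yy c d _ = y
      unfold yy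
      rw [sin_arcsin (by linarith) h4.le, sq_sqrt h2.le, mul_div_cancel₀ _ hδ.ne']
      rw [sub_sub_cancel, sqrt_sq (by linarith)]
  rw [intervalIntegral.integral_of_le hdc.le, integral_Ioc_eq_integral_Ioo, ← him,
    integral_image_eq_integral_abs_deriv_smul
      (f' := fun θ => -((c^2 - d^2) * sin θ * cos θ / yy c d θ)) measurableSet_Ioo]
  · refine setIntegral_congr_fun measurableSet_Ioo ?_
    intro φ hφ
    obtain ⟨h1, h2⟩ := sincos_pos hφ
    have := yy_ge hd hdc φ
    have h3 : 0 < yy c d φ := by linarith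
    simp only [smul_eq_mul]
    rw [abs_neg, abs_of_pos (by positivity)]
  · intro φ _
    have h := yy_sq_pos hd hdc φ
    have h1 : HasDerivAt (fun θ => c^2 - (c^2 - d^2) * sin θ ^2)
        (-((c^2-d^2) * (2 * sin φ * cos φ))) φ := by
      have := (((hasDerivAt_sin φ).pow 2).const_mul (c^2-d^2)).const_sub (c^2)
      exact this.congr_deriv (by simp)
    have h2 := h1.sqrt (by nlinarith)
    refine HasDerivAt.hasDerivWithinAt ?_
    refine HasDerivAt.congr_deriv (f := yy c d) h2 ?_
    unfold yy
    field_simp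
  · intro a ha b hb hab
    have e1 := yy_sq hd hdc a
    have e2 := yy_sq hd hdc b
    have hab' : yy c d a = yy c d b := hab
    rw [hab', e2] at e1
    have h3 : sin a ^2 = sin b ^2 := by
      have : (c^2-d^2) * (sin a ^2) = (c^2-d^2) * sin b ^2 := by linarith
      exact mul_left_cancel₀ hδ.ne' this
    have h4 : sin a = sin b := by
      rwa [pow_left_inj₀ (sincos_pos ha).1.le (sincos_pos hb).1.le two_ne_zero] at h3
    exact injOn_sin ⟨by linarith [ha.1, pi_pos], ha.2.le⟩ ⟨by linarith [hb.1, pi_pos], hb.2.le⟩ h4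

/-- `R(φ) = √(δ + d² sin²φ)`. -/
noncomputable def RR (c d φ : ℝ) : ℝ := √((c^2 - d^2) + d^2 * sin φ ^2)

lemma RR_pos {c d : ℝ} (hd : 0 < d) (hdc : d < c) (φ : ℝ) : 0 < RR c d φ :=
  sqrt_pos.2 (by nlinarith [sq_nonneg (d * sin φ)])

lemma RR_sq {c d : ℝ} (hd : 0 < d) (hdc : d < c) (φ : ℝ) :
    RR c d φ ^ 2 = (c^2 - d^2) + d^2 * sin φ ^2 :=
  sq_sqrt (by nlinarith [sq_nonneg (d * sin φ)])

lemma RR_cont (c d : ℝ) : Continuous (RR c d) := by unfold RR; fun_prop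

lemma RRinv_cont {c d : ℝ} (hd : 0 < d) (hdc : d < c) : Continuous (fun φ => 1 / RR c d φ) :=
  continuous_const.div (RR_cont c d) (fun φ => (RR_pos hd hdc φ).ne')

/-- `E = ∫ R`. -/
noncomputable def EE (c d : ℝ) : ℝ := ∫ φ in (0:ℝ)..(π/2), RR c d φ

lemma I1_eq {c d : ℝ} (hd : 0 < d) (hdc : d < c) :
    I1 c d = ∫ φ in (0:ℝ)..(π/2), 1 / RR c d φ := by
  unfold I1
  rw [cv1 d hd]
  apply aux_Ioo_eq
  intro φ hφ
  obtain ⟨h1, h2⟩ := sincos_pos hφ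
  have hR := RR_pos hd hdc φ
  have e1 : c^2 - (d * cos φ)^2 = RR c d φ ^2 := by
    rw [RR_sq hd hdc]; nlinarith [sin_sq_add_cos_sq φ]
  have e2 : d^2 - (d * cos φ)^2 = (d * sin φ)^2 := by
    nlinarith [sin_sq_add_cos_sq φ]
  rw [e1, e2, ← mul_pow, sqrt_sq (by positivity)]
  field_simp

lemma w_eq {c d : ℝ} (hd : 0 < d) (hdc : d < c) {φ : ℝ} (hφ : φ ∈ Ioo 0 (π/2)) :
    √((d^2 - (d * cos φ)^2) / (c^2 - (d * cos φ)^2)) = d * sin φ / RR c d φ := by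
  obtain ⟨h1, h2⟩ := sincos_pos hφ
  have hR := RR_pos hd hdc φ
  have e1 : c^2 - (d * cos φ)^2 = RR c d φ ^2 := by
    rw [RR_sq hd hdc]; nlinarith [sin_sq_add_cos_sq φ]
  have e2 : d^2 - (d * cos φ)^2 = (d * sin φ)^2 := by
    nlinarith [sin_sq_add_cos_sq φ]
  rw [e1, e2, ← div_pow, sqrt_sq (by positivity)]

lemma den_eq {c d : ℝ} (hd : 0 < d) (hdc : d < c) :
    (∫ y in (0:ℝ)..d, √((d^2 - y^2) / (c^2 - y^2))) = EE c d - (c^2 - d^2) * I1 c d := by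
  rw [cv1 d hd, I1_eq hd hdc]
  unfold EE
  rw [← intervalIntegral.integral_const_mul, ← intervalIntegral.integral_sub]
  · apply aux_Ioo_eq
    intro φ hφ
    rw [w_eq hd hdc hφ]
    have hR := RR_pos hd hdc φ
    field_simp
    rw [RR_sq hd hdc]; ring
  · exact (RR_cont c d).intervalIntegrable _ _
  · exact ((RRinv_cont hd hdc).const_mul _).intervalIntegrable _ _

lemma num_eq {c d : ℝ} (hd : 0 < d) (hdc : d < c) :
    (∫ y in (0:ℝ)..d, y^2 * √((d^2 - y^2) / (c^2 - y^2))) =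
      (c^2 + (c^2 - d^2)) * EE c d / 3 - 2 / 3 * c^2 * (c^2 - d^2) * I1 c d := by
  have hRc := RR_cont c d
  have hRi := RRinv_cont hd hdc
  have key : ∫ φ in (0:ℝ)..(π/2), ((2*c^2 + 2*(c^2-d^2)) * RR c d φ - 3 * RR c d φ ^3
      - c^2 * (c^2-d^2) * (1 / RR c d φ)) = 0 := by
    have : ∀ φ ∈ uIcc 0 (π/2), HasDerivAt (fun φ => d^2 * (sin φ * cos φ * RR c d φ))
      ((2*c^2 + 2*(c^2-d^2)) * RR c d φ - 3 * RR c d φ ^3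
      - c^2 * (c^2-d^2) * (1 / RR c d φ)) φ := by
      intro φ _
      have hR := RR_pos hd hdc φ
      have e := RR_sq hd hdc φ
      have h1 : HasDerivAt (fun θ => (c^2 - d^2) + d^2 * sin θ ^2)
          (d^2 * (2 * sin φ * cos φ)) φ := by
        have := (((hasDerivAt_sin φ).pow 2).const_mul (d^2)).const_add (c^2-d^2)
        exact this.congr_deriv (by simp)
      have h2 : HasDerivAt (RR c d) _ φ :=
        h1.sqrt (by nlinarith [sq_nonneg (d * sin φ)])
      have h3 := (((hasDerivAt_sin φ).mul (hasDerivAt_cos φ)).mul h2).const_mul (d^2)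
      refine h3.congr_deriv ?_
      symm
      change _ = d^2 * ((cos φ * cos φ + sin φ * -sin φ) * RR c d φ
        + sin φ * cos φ * (d^2 * (2 * sin φ * cos φ) / (2 * RR c d φ)))
      have e3 : d^2 * sin φ ^2 = RR c d φ ^2 - (c^2 - d^2) := by linarith
      have e4 : d^2 * cos φ ^2 = c^2 - RR c d φ ^2 := by
        rw [cos_sq']; linarith
      have e5 : d^2 * ((cos φ * cos φ + sin φ * -sin φ) * RR c d φ
        + sin φ * cos φ * (d^2 * (2 * sin φ * cos φ) / (2 * RR c d φ))) =
        (d^2 * cos φ ^2 - d^2 * sin φ ^2) * RR c d φ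
         + (d^2 * sin φ ^2) * (d^2 * cos φ ^2) / RR c d φ := by
        field_simp; ring
      rw [e5, e3, e4]
      field_simp
      ring
    rw [intervalIntegral.integral_eq_sub_of_hasDerivAt this]
    · simp
    · apply Continuous.intervalIntegrable; fun_prop
  have key2 : ∀ A B : ℝ, ∫ φ in (0:ℝ)..(π/2), (A * RR c d φ + B * (1 / RR c d φ))
      = A * EE c d + B * I1 c d := by
    intro A B
    rw [I1_eq hd hdc, intervalIntegral.integral_add, intervalIntegral.integral_const_mul,
      intervalIntegral.integral_const_mul, EE]
    · apply Continuous.intervalIntegrable; fun_prop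
    · apply Continuous.intervalIntegrable; fun_prop
  rw [cv1 d hd]
  have : ∫ φ in Ioo 0 (π/2), (d * sin φ) * ((d * cos φ)^2 *
      √((d^2 - (d * cos φ)^2) / (c^2 - (d * cos φ)^2))) =
      ∫ φ in (0:ℝ)..(π/2), (1/3 * ((2*c^2 + 2*(c^2-d^2)) * RR c d φ - 3 * RR c d φ ^3
      - c^2 * (c^2-d^2) * (1 / RR c d φ)) + (((c^2 + (c^2 - d^2)) / 3) * RR c d φ
       + (- (2 / 3 * c^2 * (c^2 - d^2))) * (1 / RR c d φ))) := by
    apply aux_Ioo_eq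
    intro φ hφ
    rw [w_eq hd hdc hφ]
    have hR := RR_pos hd hdc φ
    have e := RR_sq hd hdc φ
    have e3 : d^2 * sin φ ^2 = RR c d φ ^2 - (c^2 - d^2) := by linarith
    have e4 : d^2 * cos φ ^2 = c^2 - RR c d φ ^2 := by
      rw [cos_sq']; linarith
    have e5 : (d * sin φ) * ((d * cos φ)^2 * (d * sin φ / RR c d φ)) =
      (d^2 * sin φ ^2) * (d^2 * cos φ ^2) / RR c d φ := by field_simp
    rw [e5, e3, e4]
    field_simp
    ring
  rw [this, intervalIntegral.integral_add, intervalIntegral.integral_const_mul, key, key2]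
  · ring
  · apply Continuous.intervalIntegrable; fun_prop
  · apply Continuous.intervalIntegrable; fun_prop

lemma EE_bounds {c d : ℝ} (hd : 0 < d) (hdc : d < c) :
    d ≤ EE c d ∧ EE c d ≤ d + √(c^2-d^2) * (π/2) := by
  have hδ : 0 < c^2 - d^2 := by nlinarith
  have hRc := RR_cont c d
  have h1 : ∫ φ in (0:ℝ)..(π/2), d * sin φ = d := by
    rw [intervalIntegral.integral_const_mul, integral_sin]; simp
  have h2 : ∫ φ in (0:ℝ)..(π/2), (d * sin φ + √(c^2-d^2)) = d + √(c^2-d^2) * (π/2) := by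
    rw [intervalIntegral.integral_add, h1]
    · simp; ring
    · apply Continuous.intervalIntegrable; fun_prop
    · apply Continuous.intervalIntegrable; fun_prop
  constructor
  · calc d = _ := h1.symm
      _ ≤ _ := by
        apply intervalIntegral.integral_mono_on (by positivity)
        · apply Continuous.intervalIntegrable; fun_prop
        · apply Continuous.intervalIntegrable; fun_prop
        · intro φ _
          apply le_sqrt_of_sq_le
          nlinarith
  · rw [← h2]
    apply intervalIntegral.integral_mono_on (by positivity)
    · apply Continuous.intervalIntegrable; fun_prop
    · apply Continuous.intervalIntegrable; fun_prop
    · intro φ hφ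
      have hs : 0 ≤ sin φ := sin_nonneg_of_nonneg_of_le_pi hφ.1 (by linarith [hφ.2, pi_pos])
      have : 0 ≤ √(c^2-d^2) := sqrt_nonneg _
      unfold RR
      rw [sqrt_le_left (by positivity)]
      have h3 := sq_sqrt hδ.le
      have : 0 ≤ d * sin φ * √(c^2-d^2) := by positivity
      nlinarith

lemma I1_bounds {c d : ℝ} (hd : 0 < d) (hdc : d < c) :
    (-log (c^2-d^2) / 2 + log (c+d)) / d ≤ I1 c d ∧
    I1 c d ≤ (-log (c^2-d^2) / 2 + log (c+d)) / d + 1 / d := by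
  have hδ : 0 < c^2 - d^2 := by nlinarith
  have hRc := RR_cont c d
  have hRi := RRinv_cont hd hdc
  have h1 : ∫ φ in (0:ℝ)..(π/2), cos φ * (1 / RR c d φ) =
      (-log (c^2-d^2) / 2 + log (c+d)) / d := by
    have : ∀ φ ∈ uIcc 0 (π/2), HasDerivAt (fun φ => log (d * sin φ + RR c d φ) / d)
        (cos φ * (1 / RR c d φ)) φ := by
      intro φ _
      have hR := RR_pos hd hdc φ
      have e := RR_sq hd hdc φ
      have h1 : HasDerivAt (fun θ => (c^2 - d^2) + d^2 * sin θ ^2)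
          (d^2 * (2 * sin φ * cos φ)) φ := by
        have := (((hasDerivAt_sin φ).pow 2).const_mul (d^2)).const_add (c^2-d^2)
        exact this.congr_deriv (by simp)
      have h2 : HasDerivAt (RR c d) (d^2 * (2 * sin φ * cos φ) / (2 * RR c d φ)) φ :=
        h1.sqrt (by nlinarith [sq_nonneg (d * sin φ)])
      have hp : 0 < d * sin φ + RR c d φ := by
        have : |d * sin φ| < RR c d φ := by
          apply lt_sqrt_of_sq_lt
          rw [sq_abs]; nlinarith
        have := neg_abs_le (d * sin φ)
        linarith
      have h3 := ((((hasDerivAt_sin φ).const_mul d).add h2).log hp.ne').div_const d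
      refine h3.congr_deriv ?_
      simp only [Pi.add_apply]
      field_simp
      try ring
    rw [intervalIntegral.integral_eq_sub_of_hasDerivAt this]
    · unfold RR
      have e1 : c^2 - d^2 + d^2 = c^2 := by ring
      simp only [sin_pi_div_two, sin_zero, one_pow, mul_one, e1, sqrt_sq (hd.trans hdc).le]
      simp only [ne_eq, OfNat.ofNat_ne_zero, not_false_eq_true, zero_pow, mul_zero, add_zero, zero_add]
      rw [log_sqrt hδ.le, add_comm d c]
      ring
    · apply Continuous.intervalIntegrable; fun_prop
  rw [I1_eq hd hdc, ← h1]
  have h2 : ∫ φ in (0:ℝ)..(π/2), 1/d * sin φ = 1/d := by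
    rw [intervalIntegral.integral_const_mul, integral_sin]; simp
  rw [← h2]
  constructor
  · apply intervalIntegral.integral_mono_on (by positivity)
    · apply Continuous.intervalIntegrable; fun_prop
    · apply Continuous.intervalIntegrable; fun_prop
    · intro φ _
      have hR := RR_pos hd hdc φ
      have := cos_le_one φ
      exact mul_le_of_le_one_left (by positivity) this
  · rw [← intervalIntegral.integral_add]
    · apply intervalIntegral.integral_mono_on (by positivity)
      · apply Continuous.intervalIntegrable; fun_prop
      · apply Continuous.intervalIntegrable; fun_prop
      · intro φ hφ
        have hR := RR_pos hd hdc φ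
        have hs : 0 ≤ sin φ := sin_nonneg_of_nonneg_of_le_pi hφ.1 (by linarith [hφ.2, pi_pos])
        have hcs : 0 ≤ cos φ := cos_nonneg_of_mem_Icc ⟨by linarith [hφ.1, pi_pos], hφ.2⟩
        have h3 : d * sin φ ≤ RR c d φ := by
          apply le_sqrt_of_sq_le
          nlinarith
        have h4 : 1 - cos φ ≤ sin φ ^2 := by nlinarith [sin_sq_add_cos_sq φ, cos_le_one φ]
        have h5 : sin φ ^2 / RR c d φ ≤ 1/d * sin φ := by
          rw [div_le_iff₀ hR]
          have : 1/d * sin φ * (d * sin φ) ≤ 1/d * sin φ * RR c d φ := by gcongr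
          have e : 1/d * sin φ * (d * sin φ) = sin φ ^2 := by field_simp
          linarith
        have h6 : (1 - cos φ) / RR c d φ ≤ sin φ ^2 / RR c d φ := by gcongr
        have h7 : 1 / RR c d φ = cos φ * (1 / RR c d φ) + (1 - cos φ) / RR c d φ := by ring
        linarith
    · apply Continuous.intervalIntegrable; fun_prop
    · apply Continuous.intervalIntegrable; fun_prop

lemma mu2_eq {c d : ℝ} (hd : 0 < d) (hdc : d < c) (hD : 0 < EE c d - (c^2-d^2) * I1 c d) :
    c^2/3 - mu2 c d = (c^2-d^2)/3 * (c^2 * I1 c d - EE c d) / (EE c d - (c^2-d^2) * I1 c d) := by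
  unfold mu2
  rw [num_eq hd hdc, den_eq hd hdc]
  field_simp
  ring

lemma mu2_nonneg {c d : ℝ} (hd : 0 ≤ d) : 0 ≤ mu2 c d := by
  unfold mu2
  apply div_nonneg
  · apply intervalIntegral.integral_nonneg hd
    intro y _
    positivity
  · apply intervalIntegral.integral_nonneg hd
    intro y _
    positivity

lemma mu2_le {c d : ℝ} (hd : 0 < d) (hdc : d < c) : mu2 c d ≤ c^2/3 := by
  have hδ : 0 < c^2 - d^2 := by nlinarith
  have hRc := RR_cont c d
  have hRi := RRinv_cont hd hdc
  have hden : 0 ≤ ∫ y in (0:ℝ)..d, √((d^2 - y^2) / (c^2 - y^2)) := by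
    apply intervalIntegral.integral_nonneg hd.le
    intro y _
    positivity
  have h : EE c d ≤ c^2 * I1 c d := by
    rw [I1_eq hd hdc, EE, ← intervalIntegral.integral_const_mul]
    apply intervalIntegral.integral_mono_on (by positivity)
    · apply Continuous.intervalIntegrable; fun_prop
    · apply Continuous.intervalIntegrable; fun_prop
    · intro φ _
      have hR := RR_pos hd hdc φ
      have e := RR_sq hd hdc φ
      have : d^2 * sin φ ^2 ≤ d^2 * 1 := by
        gcongr; exact sin_sq_le_one φ
      rw [mul_one_div, le_div_iff₀ hR]
      nlinarith
  unfold mu2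
  apply div_le_of_le_mul₀ hden (by positivity)
  rw [num_eq hd hdc, den_eq hd hdc]
  nlinarith [mul_nonneg hδ.le (sub_nonneg.2 h)]

lemma yy_cont (c d : ℝ) : Continuous (yy c d) := by unfold yy; fun_prop

lemma yyinv_cont {c d : ℝ} (hd : 0 < d) (hdc : d < c) : Continuous (fun φ => 1 / yy c d φ) :=
  continuous_const.div (yy_cont c d) (fun φ => (hd.trans_le (yy_ge hd hdc φ)).ne')

lemma Bg_eq {c d : ℝ} (hd : 0 < d) (hdc : d < c) :
    Bg c d = 24 * ∫ θ in (0:ℝ)..(π/2),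
      (yy c d θ - mu2 c d * (1 / yy c d θ)) * (c^2 - d^2) * cos θ ^2 := by
  have hδ : 0 < c^2 - d^2 := by nlinarith
  unfold Bg
  rw [cv2 c d hd hdc]
  congr 1
  apply aux_Ioo_eq
  intro θ hθ
  obtain ⟨h1, h2⟩ := sincos_pos hθ
  have hy : 0 < yy c d θ := hd.trans_le (yy_ge hd hdc θ)
  have e := yy_sq hd hdc θ
  have e1 : yy c d θ ^2 - d^2 = (c^2-d^2) * cos θ ^2 := by rw [e, cos_sq']; ring
  have e2 : c^2 - yy c d θ ^2 = (c^2-d^2) * sin θ ^2 := by rw [e]; ring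
  rw [e1, e2, sqrt_mul hδ.le, sqrt_mul hδ.le, sqrt_sq h1.le, sqrt_sq h2.le]
  have : 0 < √(c^2-d^2) := sqrt_pos.2 hδ
  field_simp

lemma Bg_bounds {c d : ℝ} (hd : 0 < d) (hdc : d < c) :
    6 * π * (d - mu2 c d / d) ≤ Bg c d / (c^2-d^2) ∧
    Bg c d / (c^2-d^2) ≤ 6 * π * (c - mu2 c d / c) := by
  have hδ : 0 < c^2 - d^2 := by nlinarith
  have hm := mu2_nonneg (c := c) hd.le
  have hc : 0 < c := hd.trans hdc
  have hyc := yy_cont c d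
  have hyi := yyinv_cont hd hdc
  have hk : ∀ k : ℝ, ∫ θ in (0:ℝ)..(π/2), k * (c^2-d^2) * cos θ ^2 = k * (c^2-d^2) * (π/4) := by
    intro k
    rw [intervalIntegral.integral_const_mul, integral_cos_sq]
    simp; left; ring
  rw [le_div_iff₀ hδ, div_le_iff₀ hδ, Bg_eq hd hdc]
  constructor
  · have : ∫ θ in (0:ℝ)..(π/2), (d - mu2 c d / d) * (c^2-d^2) * cos θ ^2 ≤ ∫ θ in (0:ℝ)..(π/2),
      (yy c d θ - mu2 c d * (1 / yy c d θ)) * (c^2 - d^2) * cos θ ^2 := by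
      apply intervalIntegral.integral_mono_on (by positivity)
      · apply Continuous.intervalIntegrable; fun_prop
      · apply Continuous.intervalIntegrable; fun_prop
      · intro θ _
        have h1 := yy_ge hd hdc θ
        have h2 : mu2 c d * (1 / yy c d θ) ≤ mu2 c d / d := by
          rw [mul_one_div]; gcongr
        gcongr
    rw [hk] at this
    linarith
  · have : ∫ θ in (0:ℝ)..(π/2),
      (yy c d θ - mu2 c d * (1 / yy c d θ)) * (c^2 - d^2) * cos θ ^2 ≤
      ∫ θ in (0:ℝ)..(π/2), (c - mu2 c d / c) * (c^2-d^2) * cos θ ^2 := by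
      apply intervalIntegral.integral_mono_on (by positivity)
      · apply Continuous.intervalIntegrable; fun_prop
      · apply Continuous.intervalIntegrable; fun_prop
      · intro θ _
        have h1 := yy_le hd hdc θ
        have h0 : 0 < yy c d θ := hd.trans_le (yy_ge hd hdc θ)
        have h2 : mu2 c d / c ≤ mu2 c d * (1 / yy c d θ) := by
          rw [mul_one_div]; gcongr
        gcongr
    rw [hk] at this
    linarith

lemma I2_eq {c d : ℝ} (hd : 0 < d) (hdc : d < c) :
    I2 c d = ∫ θ in (0:ℝ)..(π/2),
      (log (c / (2 * √(c^2-d^2))) - log (sin θ)) * (1 / yy c d θ) := by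
  have hδ : 0 < c^2 - d^2 := by nlinarith
  have hc : 0 < c := hd.trans hdc
  unfold I2
  rw [cv2 c d hd hdc]
  apply aux_Ioo_eq
  intro θ hθ
  obtain ⟨h1, h2⟩ := sincos_pos hθ
  have hy : 0 < yy c d θ := hd.trans_le (yy_ge hd hdc θ)
  have e := yy_sq hd hdc θ
  have e1 : yy c d θ ^2 - d^2 = (c^2-d^2) * cos θ ^2 := by rw [e, cos_sq']; ring
  have e2 : c^2 - yy c d θ ^2 = (c^2-d^2) * sin θ ^2 := by rw [e]; ring
  have : 0 < √(c^2-d^2) := sqrt_pos.2 hδ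
  have e3 : (c^2-d^2) * sin θ ^2 * ((c^2-d^2) * cos θ ^2) = ((c^2-d^2) * sin θ * cos θ)^2 := by ring
  rw [e1, e2, e3, sqrt_sq (by positivity), sqrt_mul hδ.le, sqrt_sq h1.le,
    ← mul_assoc, ← div_div c, log_div (by positivity) h1.ne']
  field_simp

lemma I2_bounds {c d : ℝ} (hd : 0 < d) (hdc : d < c) (hsm : 2 * √(c^2-d^2) ≤ c) :
    (π/2) * (log c - log (c^2-d^2) / 2) / c ≤ I2 c d ∧
    I2 c d ≤ (π/2) * (log c - log (c^2-d^2) / 2) / d := by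
  have hδ : 0 < c^2 - d^2 := by nlinarith
  have hc : 0 < c := hd.trans hdc
  have hs : 0 < √(c^2-d^2) := sqrt_pos.2 hδ
  have hyi := yyinv_cont hd hdc
  set A := log (c / (2 * √(c^2-d^2))) with hA
  have hA0 : 0 ≤ A := log_nonneg ((one_le_div (by positivity)).2 hsm)
  have hAe : A = log c - log 2 - log (c^2-d^2) / 2 := by
    rw [hA, log_div hc.ne' (by positivity), log_mul two_ne_zero hs.ne', log_sqrt hδ.le]
    ring
  have hi : IntervalIntegrable (fun θ => A - log (sin θ)) volume 0 (π/2) :=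
    (intervalIntegrable_const).sub intervalIntegrable_log_sin
  have hk : ∀ k : ℝ, ∫ θ in (0:ℝ)..(π/2), (A - log (sin θ)) * (1/k) =
      (π/2) * (log c - log (c^2-d^2) / 2) / k := by
    intro k
    have hls : IntervalIntegrable (fun θ => log (sin θ)) volume 0 (π/2) :=
      intervalIntegrable_log_sin
    rw [intervalIntegral.integral_mul_const, intervalIntegral.integral_sub
      intervalIntegrable_const hls, integral_log_sin_zero_pi_div_two, hAe]
    simp
    ring
  have hp : ∀ θ, 0 ≤ A - log (sin θ) := by
    intro θ
    have : log (sin θ) ≤ 0 := by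
      rw [← log_abs]; exact log_nonpos (abs_nonneg _) (abs_sin_le_one θ)
    linarith
  rw [I2_eq hd hdc, ← hk, ← hk]
  have hi2 : IntervalIntegrable (fun θ => (A - log (sin θ)) * (1 / yy c d θ)) volume 0 (π/2) :=
    hi.mul_continuousOn hyi.continuousOn
  constructor
  · apply intervalIntegral.integral_mono_on (by positivity) (hi.mul_const _) hi2
    intro θ _
    have h1 := yy_le hd hdc θ
    have h0 : 0 < yy c d θ := hd.trans_le (yy_ge hd hdc θ)
    have := hp θ
    gcongr
  · apply intervalIntegral.integral_mono_on (by positivity) hi2 (hi.mul_const _)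
    intro θ _
    have h1 := yy_ge hd hdc θ
    have := hp θ
    gcongr

/-! ### Asymptotics as `d → c⁻` -/

lemma ev_pos {c : ℝ} (hc : 0 < c) : ∀ᶠ d in 𝓝[<] c, 0 < d ∧ d < c :=
  Ioo_mem_nhdsLT hc

lemma tend_id (c : ℝ) : Tendsto (fun d : ℝ => d) (𝓝[<] c) (𝓝 c) := nhdsWithin_le_nhds

lemma tend_delta0 (c : ℝ) : Tendsto (fun d : ℝ => c^2 - d^2) (𝓝[<] c) (𝓝 0) := by
  have := ((tend_id c).pow 2).const_sub (c^2)
  simpa using this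

lemma tend_delta {c : ℝ} (hc : 0 < c) :
    Tendsto (fun d : ℝ => c^2 - d^2) (𝓝[<] c) (𝓝[>] 0) := by
  apply tendsto_nhdsWithin_of_tendsto_nhds_of_eventually_within _ (tend_delta0 c)
  filter_upwards [ev_pos hc] with d hd
  show 0 < c^2 - d^2
  nlinarith [hd.1, hd.2]

lemma tend_L {c : ℝ} (hc : 0 < c) :
    Tendsto (fun d : ℝ => -log (c^2 - d^2)) (𝓝[<] c) atTop :=
  tendsto_neg_atBot_atTop.comp (tendsto_log_nhdsGT_zero.comp (tend_delta hc))

lemma tend_deltaL {c : ℝ} (_hc : 0 < c) :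
    Tendsto (fun d : ℝ => (c^2 - d^2) * (-log (c^2 - d^2))) (𝓝[<] c) (𝓝 0) := by
  have h := (continuous_mul_log.tendsto 0).comp (tend_delta0 c)
  simpa [Function.comp_def] using h.neg

lemma tend_div_L {c : ℝ} (hc : 0 < c) {g : ℝ → ℝ} {a : ℝ} (hg : Tendsto g (𝓝[<] c) (𝓝 a)) :
    Tendsto (fun d : ℝ => g d / (-log (c^2 - d^2))) (𝓝[<] c) (𝓝 0) :=
  hg.div_atTop (tend_L hc)

lemma tend_logsum {c : ℝ} (hc : 0 < c) :
    Tendsto (fun d : ℝ => log (c + d)) (𝓝[<] c) (𝓝 (log (c + c))) :=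
  ((tend_id c).const_add c).log (by positivity)

lemma tend_I1 {c : ℝ} (hc : 0 < c) :
    Tendsto (fun d : ℝ => I1 c d / (-log (c^2 - d^2))) (𝓝[<] c) (𝓝 (1 / (2*c))) := by
  have hd := tend_id c
  have h1 : Tendsto (fun d : ℝ => (1/2 + log (c+d) / (-log (c^2-d^2))) / d) (𝓝[<] c)
      (𝓝 (1 / (2*c))) := by
    have := ((tend_div_L hc (tend_logsum hc)).const_add (1/2)).div hd hc.ne'
    have e : (1/2 + 0) / c = 1 / (2*c) := by field_simp; norm_num
    rwa [e] at this
  have h2 : Tendsto (fun d : ℝ => (1/2 + log (c+d) / (-log (c^2-d^2))) / d +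
      (1 / d) / (-log (c^2-d^2))) (𝓝[<] c) (𝓝 (1 / (2*c))) := by
    have := h1.add (tend_div_L hc ((tendsto_const_nhds (x := (1:ℝ))).div hd hc.ne'))
    simpa using this
  refine tendsto_of_tendsto_of_tendsto_of_le_of_le' h1 h2 ?_ ?_
  · filter_upwards [ev_pos hc, (tend_L hc).eventually_gt_atTop 0] with d hd hL
    rw [le_div_iff₀ hL]
    refine le_trans (le_of_eq ?_) (I1_bounds hd.1 hd.2).1
    have := hd.1
    have := hL.ne'
    generalize -log (c^2-d^2) = L at *
    field_simp
  · filter_upwards [ev_pos hc, (tend_L hc).eventually_gt_atTop 0] with d hd hL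
    rw [div_le_iff₀ hL]
    refine le_trans (I1_bounds hd.1 hd.2).2 (le_of_eq ?_)
    have := hd.1
    have := hL.ne'
    generalize -log (c^2-d^2) = L at *
    field_simp

lemma tend_E {c : ℝ} (hc : 0 < c) : Tendsto (fun d : ℝ => EE c d) (𝓝[<] c) (𝓝 c) := by
  have hd := tend_id c
  have h2 : Tendsto (fun d : ℝ => d + √(c^2-d^2) * (π/2)) (𝓝[<] c) (𝓝 c) := by
    have := hd.add ((tend_delta0 c).sqrt.mul_const (π/2))
    simpa using this
  refine tendsto_of_tendsto_of_tendsto_of_le_of_le' hd h2 ?_ ?_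
  · filter_upwards [ev_pos hc] with d hd using (EE_bounds hd.1 hd.2).1
  · filter_upwards [ev_pos hc] with d hd using (EE_bounds hd.1 hd.2).2

lemma tend_D {c : ℝ} (hc : 0 < c) :
    Tendsto (fun d : ℝ => EE c d - (c^2-d^2) * I1 c d) (𝓝[<] c) (𝓝 c) := by
  have h := (tend_E hc).sub ((tend_deltaL hc).mul (tend_I1 hc))
  rw [zero_mul, sub_zero] at h
  refine h.congr' ?_
  filter_upwards [(tend_L hc).eventually_gt_atTop 0] with d hL
  rw [mul_assoc, mul_div_cancel₀ _ hL.ne']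

lemma tend_mu {c : ℝ} (hc : 0 < c) :
    Tendsto (fun d : ℝ => (c^2/3 - mu2 c d) / ((c^2-d^2) * (-log (c^2-d^2)))) (𝓝[<] c)
      (𝓝 (1/6)) := by
  have h := ((((tend_I1 hc).const_mul (c^2)).sub (tend_div_L hc (tend_E hc))).div
    (tend_D hc) hc.ne').const_mul (1/3)
  have e : (1/3 : ℝ) * ((c^2 * (1 / (2*c)) - 0) / c) = 1/6 := by field_simp; ring
  rw [e] at h
  refine h.congr' ?_
  filter_upwards [(tend_L hc).eventually_gt_atTop 0, ev_pos hc,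
    (tend_D hc).eventually (lt_mem_nhds hc)] with d hL hd hD
  rw [mu2_eq hd.1 hd.2 hD]
  have hδ : 0 < c^2 - d^2 := by nlinarith [hd.1, hd.2]
  have := hL.ne'
  have := hD.ne'
  simp only [Pi.div_apply]
  generalize -log (c^2-d^2) = L at *
  field_simp

lemma tend_mu0 {c : ℝ} (hc : 0 < c) :
    Tendsto (fun d : ℝ => mu2 c d) (𝓝[<] c) (𝓝 (c^2/3)) := by
  have h := ((tend_mu hc).mul (tend_deltaL hc)).const_sub (c^2/3)
  rw [mul_zero, sub_zero] at h
  refine h.congr' ?_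
  filter_upwards [(tend_L hc).eventually_gt_atTop 0, ev_pos hc] with d hL hd
  have hδ : 0 < c^2 - d^2 := by nlinarith [hd.1, hd.2]
  rw [div_mul_cancel₀ _ (by positivity)]
  ring

lemma tend_Bg {c : ℝ} (hc : 0 < c) :
    Tendsto (fun d : ℝ => Bg c d / (c^2-d^2)) (𝓝[<] c) (𝓝 (4*π*c)) := by
  have h1 := ((tend_id c).sub ((tend_mu0 hc).div (tend_id c) hc.ne')).const_mul (6*π)
  have h2 := (((tend_mu0 hc).div_const c).const_sub c).const_mul (6*π)
  have e : 6 * π * (c - c^2/3/c) = 4*π*c := by field_simp; norm_num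
  rw [e] at h1 h2
  refine tendsto_of_tendsto_of_tendsto_of_le_of_le' h1 h2 ?_ ?_
  · filter_upwards [ev_pos hc] with d hd using (Bg_bounds hd.1 hd.2).1
  · filter_upwards [ev_pos hc] with d hd using (Bg_bounds hd.1 hd.2).2

lemma tend_I2 {c : ℝ} (hc : 0 < c) :
    Tendsto (fun d : ℝ => I2 c d / (-log (c^2 - d^2))) (𝓝[<] c) (𝓝 (π / (4*c))) := by
  have h0 := ((tend_div_L hc (tendsto_const_nhds (x := log c))).add_const (1/2)).const_mul (π/2)
  have h1 := h0.div_const c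
  have h2 := h0.div (tend_id c) hc.ne'
  have e : π / 2 * (0 + 1/2) / c = π / (4*c) := by field_simp; norm_num
  rw [e] at h1 h2
  have hsm : ∀ᶠ d in 𝓝[<] c, 2 * √(c^2-d^2) ≤ c := by
    have : Tendsto (fun d => 2 * √(c^2-d^2)) (𝓝[<] c) (𝓝 0) := by
      simpa using (tend_delta0 c).sqrt.const_mul 2
    exact this.eventually (ge_mem_nhds hc)
  refine tendsto_of_tendsto_of_tendsto_of_le_of_le' h1 h2 ?_ ?_
  · filter_upwards [ev_pos hc, hsm, (tend_L hc).eventually_gt_atTop 0] with d hd hs hL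
    rw [le_div_iff₀ hL]
    refine le_trans (le_of_eq ?_) (I2_bounds hd.1 hd.2 hs).1
    have := hL.ne'
    rw [show log c - log (c^2-d^2)/2 = log c + (-log (c^2-d^2))/2 by ring]
    generalize -log (c^2-d^2) = L at *
    field_simp
  · filter_upwards [ev_pos hc, hsm, (tend_L hc).eventually_gt_atTop 0] with d hd hs hL
    rw [div_le_iff₀ hL]
    refine le_trans (I2_bounds hd.1 hd.2 hs).2 (le_of_eq ?_)
    have := hL.ne'
    have := hd.1
    rw [show log c - log (c^2-d^2)/2 = log c + (-log (c^2-d^2))/2 by ring]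
    simp only [Pi.div_apply]
    generalize -log (c^2-d^2) = L at *
    field_simp

lemma tend_Delta {c : ℝ} (hc : 0 < c) :
    Tendsto (fun d : ℝ => Delta c d) (𝓝[<] c) (𝓝 (-(π/2))) := by
  have h := ((tend_I2 hc).div (tend_I1 hc) (by positivity)).neg
  have e : -(π / (4*c) / (1 / (2*c))) = -(π/2) := by field_simp; norm_num
  rw [e] at h
  refine h.congr' ?_
  filter_upwards [(tend_L hc).eventually_gt_atTop 0] with d hL
  unfold Delta
  simp only [Pi.div_apply]
  rw [div_div_div_cancel_right₀ hL.ne', neg_div]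

lemma mu2_sum_lt {c d : ℝ} (hd : 0 ≤ d) (hdc : d < c) : mu2 c d + d^2/2 < 5*c^2/6 := by
  rcases hd.eq_or_lt with rfl | hd
  · have : mu2 c 0 = 0 := by simp [mu2]
    rw [this]; have : 0 < c^2 := by positivity
    linarith
  · have := mu2_le hd hdc
    nlinarith

/-- The limit statement along an arbitrary filter. -/
lemma main_limit {ι : Type*} (F : Filter ι) {c a b : ℝ} (hc : 0 < c) (ha : 0 < a)
    (t s D η : ι → ℝ) (ht : Tendsto t F atTop)
    (hs : ∀ᶠ p in F, a ≤ s p ∧ s p ≤ b)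
    (hη : ∀ᶠ p in F, 12 * t p * η p = s p * log (t p))
    (hD : Tendsto D F (𝓝[<] c))
    (hrel : ∀ᶠ p in F, η p = (c^2/3 - mu2 c (D p)) + (c^2 - (D p)^2)/2) :
    ∃ G : ι → ℝ, Tendsto G F (𝓝 (4 * π * c / 2)) ∧
      ∀ᶠ p in F, t p * Bg c (D p) = s p * G p := by
  have hlt : Tendsto (fun p => log (t p)) F atTop := tendsto_log_atTop.comp ht
  set δ : ι → ℝ := fun p => c^2 - (D p)^2 with hδdef
  have hδ : Tendsto δ F (𝓝[>] 0) := (tend_delta hc).comp hD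
  have hδ0 : ∀ᶠ p in F, 0 < δ p := hδ.eventually self_mem_nhdsWithin
  set L : ι → ℝ := fun p => -log (δ p) with hLdef
  have hL : Tendsto L F atTop := (tend_L hc).comp hD
  set κ : ι → ℝ := fun p => η p / (δ p * L p) with hκdef
  have hκ : Tendsto κ F (𝓝 (1/6)) := by
    have h1 := (tend_mu hc).comp hD
    have h2 : Tendsto (fun p => (1/2 : ℝ) / L p) F (𝓝 0) := tendsto_const_nhds.div_atTop hL
    have h3 := h1.add h2
    rw [add_zero] at h3
    refine h3.congr' ?_
    filter_upwards [hrel, hδ0, hL.eventually_gt_atTop 0] with p hr h0 hL0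
    have hr' : η p = (c^2/3 - mu2 c (D p)) + δ p / 2 := hr
    simp only [Function.comp_apply, hκdef]
    rw [hr']
    change (c^2/3 - mu2 c (D p)) / (δ p * L p) + 1 / 2 / L p = _
    field_simp
  have hκ0 : ∀ᶠ p in F, 0 < κ p := hκ.eventually (lt_mem_nhds (by norm_num))
  -- log η in terms of L
  have hl1 : Tendsto (fun p => -log (η p) / L p) F (𝓝 1) := by
    have h1 : Tendsto (fun p => log (κ p) / L p) F (𝓝 0) :=
      (hκ.log (by norm_num)).div_atTop hL
    have h2 : Tendsto (fun p => log (L p) / L p) F (𝓝 0) :=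
      (isLittleO_log_id_atTop.tendsto_div_nhds_zero).comp hL
    have h3 := (h1.add h2).const_sub 1
    rw [add_zero, sub_zero] at h3
    refine h3.congr' ?_
    filter_upwards [hδ0, hL.eventually_gt_atTop 0, hκ0] with p h0 hL0 hk0
    have e : η p = κ p * (δ p * L p) := by
      simp only [hκdef]; field_simp
    rw [e, log_mul hk0.ne' (by positivity), log_mul h0.ne' hL0.ne']
    have e2 : log (δ p) = - L p := by simp [hLdef]
    rw [e2]
    field_simp
    ring
  have hl2 : Tendsto (fun p => -log (η p) / log (t p)) F (𝓝 1) := by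
    have h2 : Tendsto (fun p => log (log (t p)) / log (t p)) F (𝓝 0) :=
      (isLittleO_log_id_atTop.tendsto_div_nhds_zero).comp hlt
    have hc1 : ∀ k : ℝ, Tendsto (fun p => k / log (t p)) F (𝓝 0) :=
      fun k => tendsto_const_nhds.div_atTop hlt
    have h1 : Tendsto (fun p => log (s p) / log (t p)) F (𝓝 0) := by
      refine tendsto_of_tendsto_of_tendsto_of_le_of_le' (hc1 (log a)) (hc1 (log b)) ?_ ?_
      · filter_upwards [hs, hlt.eventually_gt_atTop 0] with p hp h0
        have := log_le_log ha hp.1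
        gcongr
      · filter_upwards [hs, hlt.eventually_gt_atTop 0] with p hp h0
        have := log_le_log (ha.trans_le hp.1) hp.2
        gcongr
    have h3 := (((hc1 (log 12)).sub h1).sub h2).const_add 1
    simp only [sub_zero, add_zero] at h3
    refine h3.congr' ?_
    filter_upwards [hs, hlt.eventually_gt_atTop 0, hη, ht.eventually_gt_atTop 0]
      with p hp h0 he ht0
    have hsp : 0 < s p := ha.trans_le hp.1
    have e : η p = s p * log (t p) / (12 * t p) := by
      field_simp; linarith
    rw [e, log_div (by positivity) (by positivity), log_mul hsp.ne' h0.ne',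
      log_mul (by norm_num) ht0.ne']
    field_simp
    ring
  have hrat : Tendsto (fun p => L p / log (t p)) F (𝓝 1) := by
    have h := hl2.div hl1 one_ne_zero
    rw [div_one] at h
    refine h.congr' ?_
    have hne : ∀ᶠ p in F, -log (η p) / L p ≠ 0 :=
      hl1.eventually_ne one_ne_zero
    filter_upwards [hL.eventually_gt_atTop 0, hlt.eventually_gt_atTop 0, hne] with p h0 h1 h2
    have h3 : -log (η p) ≠ 0 := fun h => h2 (by rw [h, zero_div])
    simp only [Pi.div_apply]
    generalize -log (η p) = w at *
    field_simp
  refine ⟨fun p => Bg c (D p) / δ p * (1 / (12 * (κ p * (L p / log (t p))))), ?_, ?_⟩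
  · have h := ((tend_Bg hc).comp hD).mul
      ((tendsto_const_nhds (x := (1:ℝ))).div ((hκ.mul hrat).const_mul 12) (by norm_num))
    have e : 4 * π * c * (1 / (12 * (1/6 * 1))) = 4 * π * c / 2 := by ring
    rw [e] at h
    exact h
  · filter_upwards [hL.eventually_gt_atTop 0, hlt.eventually_gt_atTop 0, hκ0, hδ0, hη]
      with p h0 h1 h2 h3 h4
    have e : η p = κ p * (δ p * L p) := by
      simp only [hκdef]; field_simp
    rw [e] at h4
    have e5 : s p = 12 * t p * (κ p * (δ p * L p)) / log (t p) := by
      rw [h4]; field_simp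
    rw [e5]
    field_simp

theorem stmt14 (c : ℝ) (hc : 0 < c) (f : ℝ → ℝ)
    (hmap : ∀ ξ ∈ Set.Icc (-c^2/2) (c^2/3), f ξ ∈ Set.Icc 0 c)
    (hcont : ContinuousOn f (Set.Icc (-c^2/2) (c^2/3)))
    (hmono : StrictMonoOn f (Set.Icc (-c^2/2) (c^2/3)))
    (hmod : ∀ ξ ∈ Set.Icc (-c^2/2) (c^2/3),
      c^2/2 + ξ = mu2 c (f ξ) + (f ξ)^2/2)
    (N : ℕ) (hN : 1 ≤ N) :
    ∃ ε₀ > 0, ∀ ε : ℝ, 0 < ε → ε < ε₀ →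
      ∃ T : ℝ, ∀ t : ℝ, T < t → ∀ x : ℝ,
        4*c^2*t - (2*N + 1/2 - ε)/(2*c) * Real.log t ≤ x →
        x ≤ 4*c^2*t - (1/2 + ε)/(2*c) * Real.log t →
        0 ≤ zvar c f t (x/(12*t)) ∧ zvar c f t (x/(12*t)) ≤ 2*N := by
  refine ⟨1/2, by norm_num, ?_⟩
  intro ε hε hε2
  have hc2 : 0 < c^2 := by positivity
  have hmem : c^2/3 ∈ Set.Icc (-c^2/2) (c^2/3) := ⟨by linarith, le_rfl⟩
  have hfc : f (c^2/3) = c := by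
    obtain ⟨h0, h1⟩ := hmap _ hmem
    by_contra hne
    have h2 := mu2_sum_lt h0 (lt_of_le_of_ne h1 hne)
    have h3 := hmod _ hmem
    linarith
  set a : ℝ := (1/2 + ε)/(2*c) with ha
  set b : ℝ := (2*N + 1/2 - ε)/(2*c) with hb
  have ha0 : 0 < a := by positivity
  let F : Filter (ℝ × ℝ) := Filter.comap Prod.fst atTop ⊓
    𝓟 {p | 4*c^2*p.1 - b * Real.log p.1 ≤ p.2 ∧ p.2 ≤ 4*c^2*p.1 - a * Real.log p.1}
  have ht : Tendsto (fun p : ℝ × ℝ => p.1) F atTop := tendsto_comap.mono_left inf_le_left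
  have hlt : Tendsto (fun p : ℝ × ℝ => Real.log p.1) F atTop := Real.tendsto_log_atTop.comp ht
  have hrange : ∀ᶠ p in F, 4*c^2*p.1 - b * Real.log p.1 ≤ p.2 ∧
      p.2 ≤ 4*c^2*p.1 - a * Real.log p.1 :=
    mem_inf_of_right (mem_principal_self _)
  let η : ℝ × ℝ → ℝ := fun p => c^2/3 - p.2/(12*p.1)
  let s : ℝ × ℝ → ℝ := fun p => 12 * p.1 * η p / Real.log p.1
  have hse : ∀ᶠ p in F, 12 * p.1 * η p = s p * Real.log p.1 := by
    filter_upwards [hlt.eventually_gt_atTop 0] with p h0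
    exact (div_mul_cancel₀ _ h0.ne').symm
  have hηe : ∀ᶠ p in F, 12 * p.1 * η p = 4*c^2*p.1 - p.2 := by
    filter_upwards [ht.eventually_gt_atTop 0] with p h0
    simp only [η]
    field_simp
    ring
  have hs : ∀ᶠ p in F, a ≤ s p ∧ s p ≤ b := by
    filter_upwards [hrange, hηe, hlt.eventually_gt_atTop 0] with p h1 h2 h3
    simp only [s]
    rw [h2, le_div_iff₀ h3, div_le_iff₀ h3]
    constructor <;> linarith [h1.1, h1.2]
  have hηpos : ∀ᶠ p in F, 0 < η p := by
    filter_upwards [hs, hse, hlt.eventually_gt_atTop 0, ht.eventually_gt_atTop 0]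
      with p h1 h2 h3 h4
    have h5 : 0 < 12 * p.1 * η p := by
      rw [h2]; exact mul_pos (ha0.trans_le h1.1) h3
    exact pos_of_mul_pos_right h5 (by positivity)
  have hη0 : Tendsto η F (𝓝 0) := by
    have h1 : Tendsto (fun p : ℝ × ℝ => b/12 * (Real.log p.1 / p.1)) F (𝓝 0) := by
      have := ((Real.isLittleO_log_id_atTop.tendsto_div_nhds_zero).comp ht).const_mul (b/12)
      simpa using this
    refine tendsto_of_tendsto_of_tendsto_of_le_of_le' tendsto_const_nhds h1 ?_ ?_
    · filter_upwards [hηpos] with p h using h.le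
    · filter_upwards [hs, hse, hlt.eventually_gt_atTop 0, ht.eventually_gt_atTop 0]
        with p h1 h2 h3 h4
      have h5 : 12 * p.1 * η p ≤ b * Real.log p.1 := by
        rw [h2]; exact mul_le_mul_of_nonneg_right h1.2 h3.le
      rw [← mul_div_assoc, le_div_iff₀ h4]
      linarith
  let ξ : ℝ × ℝ → ℝ := fun p => p.2/(12*p.1)
  have hξη : ∀ p, ξ p = c^2/3 - η p := fun p => by simp only [ξ, η]; ring
  have hξ : Tendsto ξ F (𝓝 (c^2/3)) := by
    have := hη0.const_sub (c^2/3)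
    rw [sub_zero] at this
    exact this.congr (fun p => (hξη p).symm)
  have hξmem : ∀ᶠ p in F, ξ p ∈ Set.Icc (-c^2/2) (c^2/3) ∧ ξ p < c^2/3 := by
    have h1 : ∀ᶠ p in F, -c^2/2 < ξ p := hξ.eventually (lt_mem_nhds (by linarith))
    filter_upwards [h1, hηpos] with p h1 h2
    have := hξη p
    exact ⟨⟨h1.le, by linarith⟩, by linarith⟩
  have hD : Tendsto (fun p => f (ξ p)) F (𝓝[<] c) := by
    apply tendsto_nhdsWithin_of_tendsto_nhds_of_eventually_within
    · have h1 := hcont _ hmem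
      rw [ContinuousWithinAt, hfc] at h1
      refine h1.comp (tendsto_nhdsWithin_of_tendsto_nhds_of_eventually_within _ hξ ?_)
      filter_upwards [hξmem] with p h using h.1
    · filter_upwards [hξmem] with p h
      have := hmono h.1 hmem h.2
      rw [hfc] at this
      exact this
  have hrel : ∀ᶠ p in F, η p = (c^2/3 - mu2 c (f (ξ p))) + (c^2 - (f (ξ p))^2)/2 := by
    filter_upwards [hξmem] with p h
    have h1 := hmod _ h.1
    have := hξη p
    linarith
  obtain ⟨G, hG, hGe⟩ := main_limit F hc ha0 (fun p => p.1) s (fun p => f (ξ p)) η ht hs hse hD hrel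
  have hΔ := (tend_Delta hc).comp hD
  have hz : ∀ᶠ p in F, 0 ≤ zvar c f p.1 (ξ p) ∧ zvar c f p.1 (ξ p) ≤ 2*N := by
    have hG2 : Tendsto (fun p => |G p / Real.pi - 2 * c|) F (𝓝 0) := by
      have h := ((hG.div_const Real.pi).sub_const (2*c)).abs
      have e : |4 * Real.pi * c / 2 / Real.pi - 2*c| = 0 := by
        rw [abs_eq_zero]
        field_simp
        ring
      rwa [e] at h
    have hΔ2 : Tendsto (fun p => |Delta c (f (ξ p)) / Real.pi + 1/2|) F (𝓝 0) := by
      have h := ((hΔ.div_const Real.pi).add_const (1/2)).abs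
      have e : |-(Real.pi / 2) / Real.pi + 1/2| = 0 := by
        rw [abs_eq_zero]
        field_simp
        ring
      rwa [e] at h
    have hb0 : 0 < b := by
      have : (1:ℝ) ≤ N := by exact_mod_cast hN
      apply div_pos _ (by positivity)
      linarith
    filter_upwards [hGe, hs, hG2.eventually (gt_mem_nhds (show 0 < ε/(2*b) by positivity)),
      hΔ2.eventually (gt_mem_nhds (show 0 < ε/2 by positivity))] with p h1 h2 h3 h4
    have hsp : 0 < s p := ha0.trans_le h2.1
    have e1 : zvar c f p.1 (ξ p) = s p * (G p / Real.pi) + Delta c (f (ξ p)) / Real.pi := by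
      unfold zvar
      rw [h1]
      ring
    have h5 : |s p * (G p / Real.pi - 2*c)| ≤ ε/2 := by
      rw [abs_mul, abs_of_pos hsp]
      calc s p * |G p / Real.pi - 2*c| ≤ b * (ε/(2*b)) := by
            apply mul_le_mul h2.2 h3.le (abs_nonneg _) hb0.le
        _ = ε/2 := by field_simp
    have h6 : 1/2 + ε ≤ 2*c*s p := by
      have := h2.1
      rw [ha, div_le_iff₀ (by positivity)] at this
      linarith
    have h7 : 2*c*s p ≤ 2*N + 1/2 - ε := by
      have := h2.2
      rw [hb, le_div_iff₀ (by positivity)] at this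
      linarith
    rw [abs_le] at h5
    rw [abs_lt] at h4
    rw [e1]
    have e2 : s p * (G p / Real.pi) = s p * (G p / Real.pi - 2*c) + 2*c*s p := by ring
    rw [e2]
    constructor
    · linarith [h5.1, h4.1]
    · linarith [h5.2, h4.2]
  have hz2 := (mem_inf_principal.1 hz : _ ∈ Filter.comap Prod.fst atTop)
  obtain ⟨S, hS, hsub⟩ := Filter.mem_comap.1 hz2
  obtain ⟨T, hT⟩ := Filter.mem_atTop_sets.1 hS
  refine ⟨T, fun t htT x hx1 hx2 => ?_⟩
  exact hsub (show (t, x) ∈ Set.preimage Prod.fst S from hT t htT.le) ⟨hx1, hx2⟩
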